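/- For all real numbers c, δ, c₁ ∈ (0,1), the following holds for all sufficiently large n ∈ ℕ. Let G be a (c, δ)-diverse graph on a vertex set V of n vertices, let W₁ ⊆ V be a set of exactly ⌈n^{1/2}⌉ vertices, and let p be a real number with √c₁ ≤ p ≤ 1/2. Let U be a random subset of V ∖ W₁ obtained by including each vertex independently with probability p. Then the expected number of unordered pairs {x, y} ⊆ W₁ with deg_U(x) = deg_U(y) is at most 2|W₁|·n^δ. -/

import Mathlib

/-- The degree of the vertex `x` into the set `U`, i.e. `|Γ(x) ∩ U|`. -/
noncomputable def degIn {V : Type*} (G : SimpleGraph V) (U : Set V) (x : V) : ℕ :=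
  (G.neighborSet x ∩ U).ncard

/-- An `n`-vertex graph `G` is `(c, δ)`-diverse if for each vertex `x`, the inequality
`|Γ(x) △ Γ(y)| ≥ c n` holds for all but at most `n^δ` vertices `y`. -/
def Diverse (c δ : ℝ) {V : Type*} [Fintype V] (G : SimpleGraph V) : Prop :=
  ∀ x : V,
    (({y : V | ((symmDiff (G.neighborSet x) (G.neighborSet y)).ncard : ℝ)
        < c * (Fintype.card V : ℝ)}).ncard : ℝ) ≤ (Fintype.card V : ℝ) ^ δ

open Finset

theorem Nat.centralBinom_sq_mul_le (n : ℕ) : n.centralBinom ^ 2 * (2 * n + 1) ≤ 16 ^ n := by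
  induction n with
  | zero => simp
  | succ n ih =>
    have h := Nat.succ_mul_centralBinom_succ n
    have h2 : (n + 1) ^ 2 * ((n + 1).centralBinom ^ 2 * (2 * (n + 1) + 1))
        ≤ (n + 1) ^ 2 * 16 ^ (n + 1) := by
      calc (n + 1) ^ 2 * ((n + 1).centralBinom ^ 2 * (2 * (n + 1) + 1))
          = ((n + 1) * (n + 1).centralBinom) ^ 2 * (2 * n + 3) := by ring
        _ = (n.centralBinom ^ 2 * (2 * n + 1)) * (4 * ((2 * n + 1) * (2 * n + 3))) := by
            rw [h]; ring
        _ ≤ 16 ^ n * (16 * (n + 1) ^ 2) := by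
            exact Nat.mul_le_mul ih (by nlinarith)
        _ = (n + 1) ^ 2 * 16 ^ (n + 1) := by ring
    exact Nat.le_of_mul_le_mul_left h2 (by positivity)

theorem Nat.choose_sq_mul_le (t k : ℕ) : t.choose k ^ 2 * (t + 1) ≤ 2 * 4 ^ t := by
  obtain ⟨s, rfl | rfl⟩ := Nat.even_or_odd' t
  · calc (2 * s).choose k ^ 2 * (2 * s + 1)
        ≤ s.centralBinom ^ 2 * (2 * s + 1) := by gcongr; exact Nat.choose_le_centralBinom k s
      _ ≤ 16 ^ s := s.centralBinom_sq_mul_le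
      _ ≤ 2 * 4 ^ (2 * s) := by rw [pow_mul]; norm_num
  · have h : (2 * s + 1).choose k ≤ 2 * s.centralBinom := by
      cases k with
      | zero =>
        have := s.centralBinom_pos
        rw [Nat.choose_zero_right]
        omega
      | succ k =>
        rw [Nat.choose_succ_succ]
        have h1 := Nat.choose_le_centralBinom k s
        have h2 := Nat.choose_le_centralBinom (k + 1) s
        simp only [Nat.succ_eq_add_one]
        omega
    calc (2 * s + 1).choose k ^ 2 * (2 * s + 1 + 1)
        ≤ (2 * s.centralBinom) ^ 2 * (2 * (2 * s + 1)) := by gcongr; omega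
      _ = 8 * (s.centralBinom ^ 2 * (2 * s + 1)) := by ring
      _ ≤ 8 * 16 ^ s := by gcongr; exact s.centralBinom_sq_mul_le
      _ = 2 * 4 ^ (2 * s + 1) := by rw [pow_succ, pow_mul]; norm_num; ring

/-- A `p`-random set is a fair random subset of a `2p`-random set. -/
theorem binomial_eq_sum_thinning (p : ℝ) {m k : ℕ} (hk : k ≤ m) :
    (m.choose k : ℝ) * p ^ k * (1 - p) ^ (m - k) =
      ∑ t ∈ range (m + 1),
        (m.choose t : ℝ) * (2 * p) ^ t * (1 - 2 * p) ^ (m - t) * (t.choose k / 2 ^ t) := by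
  have h1 : ∑ t ∈ range (m + 1),
        (m.choose t : ℝ) * (2 * p) ^ t * (1 - 2 * p) ^ (m - t) * (t.choose k / 2 ^ t)
      = ∑ t ∈ Ico k (m + 1),
        (m.choose t : ℝ) * (2 * p) ^ t * (1 - 2 * p) ^ (m - t) * (t.choose k / 2 ^ t) := by
    symm
    refine sum_subset (fun t ht => ?_) fun t ht ht' => ?_
    · simp only [mem_Ico, mem_range] at *; omega
    · rw [Nat.choose_eq_zero_of_lt (n := t)]
      · simp
      · simp only [mem_Ico, mem_range] at *; omega
  rw [h1, sum_Ico_eq_sum_range]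
  have h2 : (1 - p) = p + (1 - 2 * p) := by ring
  rw [h2, add_pow, mul_sum, show m + 1 - k = m - k + 1 by omega]
  refine sum_congr rfl fun j hj => ?_
  have hj' : j ≤ m - k := by simp only [mem_range] at hj; omega
  have h3 : (m.choose (k + j) : ℝ) * (k + j).choose k = m.choose k * (m - k).choose j := by
    have := Nat.choose_mul (n := m) (k := k + j) (s := k) (by omega)
    rw [Nat.add_sub_cancel_left] at this
    exact_mod_cast this
  rw [show m - (k + j) = m - k - j by omega, mul_pow]
  calc _ = (m.choose k * (m - k).choose j : ℝ) * (p ^ (k + j) * (1 - 2 * p) ^ (m - k - j)) := by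
        rw [pow_add]; ring
    _ = _ := by rw [← h3]; field_simp

theorem sum_binomial_eq_one (q : ℝ) (m : ℕ) :
    ∑ t ∈ range (m + 1), (m.choose t : ℝ) * q ^ t * (1 - q) ^ (m - t) = 1 := by
  have h := add_pow q (1 - q) m
  rw [add_sub_cancel, one_pow] at h
  refine Eq.trans ?_ h.symm
  exact sum_congr rfl fun t _ => by ring

theorem sum_binomial_div_succ_le {q : ℝ} (hq : 0 < q) (hq1 : q ≤ 1) (m : ℕ) :
    ∑ t ∈ range (m + 1), (m.choose t : ℝ) * q ^ t * (1 - q) ^ (m - t) * (1 / (t + 1))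
      ≤ 1 / (q * (m + 1)) := by
  have h := sum_binomial_eq_one q (m + 1)
  rw [sum_range_succ'] at h
  have h0 : 0 ≤ ((m + 1).choose 0 : ℝ) * q ^ 0 * (1 - q) ^ (m + 1 - 0) := by
    have : 0 ≤ 1 - q := by linarith
    positivity
  rw [le_div_iff₀ (by positivity), sum_mul]
  refine le_trans (le_of_eq (sum_congr rfl fun t _ => ?_)) (by linarith :
    ∑ t ∈ range (m + 1), ((m + 1).choose (t + 1) : ℝ) * q ^ (t + 1) * (1 - q) ^ (m + 1 - (t + 1))
      ≤ 1)
  have h1 : ((m : ℝ) + 1) * m.choose t = (m + 1).choose (t + 1) * (t + 1) := by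
    exact_mod_cast Nat.add_one_mul_choose_eq m t
  rw [Nat.add_sub_add_right]
  have h2 : ((m + 1).choose (t + 1) : ℝ) = (m + 1) * m.choose t / (t + 1) := by
    rw [h1]; field_simp
  rw [h2]
  field_simp
  ring

theorem binomial_le {p : ℝ} (hp : 0 < p) (hp2 : p ≤ 1 / 2) (m k : ℕ) :
    (m.choose k : ℝ) * p ^ k * (1 - p) ^ (m - k) ≤ 1 / (p * √(m + 1)) := by
  rcases lt_or_ge m k with hk | hk
  · rw [Nat.choose_eq_zero_of_lt hk]
    simp only [Nat.cast_zero, zero_mul]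
    positivity
  rw [binomial_eq_sum_thinning p hk]
  set a : ℝ := √(m + 1)
  have ha0 : 0 < a := by positivity
  have ha2 : a ^ 2 = m + 1 := Real.sq_sqrt (by positivity)
  have key (t : ℕ) : (t.choose k / 2 ^ t : ℝ) ≤ a * (1 / (t + 1)) + 1 / (2 * a) := by
    have h1 : (t.choose k / 2 ^ t : ℝ) ^ 2 * (t + 1) ≤ 2 := by
      have h : (t.choose k : ℝ) ^ 2 * (t + 1) ≤ 2 * 4 ^ t := by
        exact_mod_cast Nat.choose_sq_mul_le t k
      rw [div_pow, ← pow_mul, mul_comm t 2, pow_mul, div_mul_eq_mul_div,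
        div_le_iff₀ (by positivity)]
      norm_num
      exact h
    have h2 : (t.choose k / 2 ^ t : ℝ) ^ 2 ≤ (a * (1 / (t + 1)) + 1 / (2 * a)) ^ 2 := by
      have h3 : (t.choose k / 2 ^ t : ℝ) ^ 2 ≤ 2 / (t + 1) := by
        rwa [le_div_iff₀ (by positivity)]
      have h4 : (a * (1 / (t + 1)) + 1 / (2 * a)) ^ 2
          = (a * (1 / (t + 1)) - 1 / (2 * a)) ^ 2 + 2 / ((t : ℝ) + 1) := by
        field_simp; ring
      rw [h4]
      nlinarith [sq_nonneg (a * (1 / (t + 1)) - 1 / (2 * a))]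
    exact (pow_le_pow_iff_left₀ (by positivity) (by positivity) two_ne_zero).1 h2
  have hq : 0 ≤ 1 - 2 * p := by linarith
  calc _ ≤ ∑ t ∈ range (m + 1), (m.choose t : ℝ) * (2 * p) ^ t * (1 - 2 * p) ^ (m - t)
          * (a * (1 / (t + 1)) + 1 / (2 * a)) := by
        refine sum_le_sum fun t _ => mul_le_mul_of_nonneg_left (key t) (by positivity)
    _ = a * ∑ t ∈ range (m + 1), (m.choose t : ℝ) * (2 * p) ^ t * (1 - 2 * p) ^ (m - t)
          * (1 / (t + 1)) + 1 / (2 * a) := by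
        simp_rw [mul_add]
        rw [sum_add_distrib, ← sum_mul, sum_binomial_eq_one, one_mul, mul_sum]
        congr 1
        exact sum_congr rfl fun t _ => by ring
    _ ≤ a * (1 / (2 * p * (m + 1))) + 1 / (2 * a) := by
        gcongr
        exact sum_binomial_div_succ_le (by positivity) (by linarith) m
    _ ≤ 1 / (p * a) := by
        rw [← ha2]
        have : a * (1 / (2 * p * a ^ 2)) + 1 / (2 * a) = (1 + p) / 2 * (1 / (p * a)) := by
          field_simp
        rw [this]
        exact mul_le_of_le_one_left (by positivity) (by linarith)

/-- The probability that a `p`-random subset of a set of size `r` is a given set of size `s`. -/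
noncomputable def bernoulliWeight (p : ℝ) (r s : ℕ) : ℝ := p ^ s * (1 - p) ^ (r - s)

theorem bernoulliWeight_nonneg {p : ℝ} (hp : 0 ≤ p) (hp1 : p ≤ 1) (r s : ℕ) :
    0 ≤ bernoulliWeight p r s :=
  mul_nonneg (pow_nonneg hp _) (pow_nonneg (sub_nonneg.2 hp1) _)

section Subsets

variable {α : Type*}

theorem sum_powerset_bernoulliWeight (p : ℝ) (R : Finset α) :
    ∑ S ∈ R.powerset, bernoulliWeight p #R #S = 1 := by
  have h := Finset.sum_pow_mul_eq_add_pow p (1 - p) R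
  simpa [bernoulliWeight] using h

variable [DecidableEq α]

theorem sum_powerset_eq_sum_inter_sdiff {R A : Finset α} (hA : A ⊆ R) (g : Finset α → ℝ) :
    ∑ S ∈ R.powerset, g S
      = ∑ T ∈ (R \ A).powerset, ∑ S ∈ A.powerset, g (S ∪ T) := by
  rw [← sum_product' (f := fun T S => g (S ∪ T))]
  refine sum_nbij' (fun S => (S \ A, S ∩ A)) (fun q => q.2 ∪ q.1) ?_ ?_ ?_ ?_ ?_
  · intro S hS
    simp only [mem_product, mem_powerset] at *
    exact ⟨sdiff_subset_sdiff hS subset_rfl, inter_subset_right⟩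
  · rintro ⟨T, S⟩ h
    simp only [mem_product, mem_powerset] at *
    exact union_subset (h.2.trans hA) (h.1.trans sdiff_subset)
  · intro S _
    grind
  · rintro ⟨T, S⟩ h
    simp only [mem_product, mem_powerset] at h
    ext <;> grind
  · intro S _
    congr 1
    grind

/-- Anticoncentration: conditionally on `S \ A`, the size of `S ∩ A` is a binomial variable. -/
theorem sum_bernoulliWeight_card_inter_eq_le {p : ℝ} (hp : 0 < p) (hp2 : p ≤ 1 / 2)
    {R A : Finset α} (hA : A ⊆ R) (f : Finset α → ℕ) :
    ∑ S ∈ R.powerset, bernoulliWeight p #R #S * (if #(S ∩ A) = f (S \ A) then 1 else 0)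
      ≤ 1 / (p * √(#A + 1)) := by
  rw [sum_powerset_eq_sum_inter_sdiff hA]
  have inner (T : Finset α) (hT : T ∈ (R \ A).powerset) :
      ∑ S ∈ A.powerset, bernoulliWeight p #R #(S ∪ T) *
          (if #((S ∪ T) ∩ A) = f ((S ∪ T) \ A) then 1 else 0)
        ≤ bernoulliWeight p #(R \ A) #T * (1 / (p * √(#A + 1))) := by
    rw [mem_powerset] at hT
    have h1 : ∀ S ∈ A.powerset, bernoulliWeight p #R #(S ∪ T) *
          (if #((S ∪ T) ∩ A) = f ((S ∪ T) \ A) then (1 : ℝ) else 0)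
        = bernoulliWeight p #(R \ A) #T *
          (bernoulliWeight p #A #S * if #S = f T then 1 else 0) := by
      intro S hS
      rw [mem_powerset] at hS
      have e1 : (S ∪ T) ∩ A = S := by grind
      have e2 : (S ∪ T) \ A = T := by grind
      have e3 : #(S ∪ T) = #S + #T := card_union_of_disjoint (by
        rw [disjoint_left]; grind)
      have e4 := card_sdiff_add_card_eq_card hA
      have e5 := card_le_card hT
      have e6 := card_le_card hS
      rw [e1, e2, e3, bernoulliWeight, bernoulliWeight, bernoulliWeight,
        show #R - (#S + #T) = (#(R \ A) - #T) + (#A - #S) by omega, pow_add, pow_add]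
      ring
    rw [sum_congr rfl h1, ← mul_sum]
    refine mul_le_mul_of_nonneg_left ?_ (bernoulliWeight_nonneg hp.le (by linarith) _ _)
    rw [sum_powerset_apply_card (fun s => bernoulliWeight p #A s * if s = f T then 1 else 0)]
    have h2 : ∑ s ∈ range (#A + 1),
          (#A).choose s • (bernoulliWeight p #A s * if s = f T then (1 : ℝ) else 0)
        ≤ (#A).choose (f T) * p ^ f T * (1 - p) ^ (#A - f T) := by
      simp only [mul_ite, mul_one, mul_zero, smul_ite, smul_zero, sum_ite_eq', nsmul_eq_mul]
      have h3 : 0 ≤ 1 - p := by linarith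
      split_ifs
      · rw [bernoulliWeight, mul_assoc]
      · positivity
    exact h2.trans (binomial_le hp hp2 _ _)
  calc _ ≤ ∑ T ∈ (R \ A).powerset, bernoulliWeight p #(R \ A) #T * (1 / (p * √(#A + 1))) :=
        sum_le_sum inner
    _ = _ := by rw [← sum_mul, sum_powerset_bernoulliWeight, one_mul]

end Subsets

section Degrees

variable {V : Type*}

open Classical in
theorem degIn_coe_eq_card_filter (G : SimpleGraph V) (S : Finset V) (x : V) :
    degIn G (S : Set V) x = #{v ∈ S | G.Adj x v} := by
  rw [degIn, ← Set.ncard_coe_finset]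
  congr 1
  ext v
  simp [and_comm]

variable [DecidableEq V]

open Classical in
theorem degIn_eq_iff (G : SimpleGraph V) {R S : Finset V} (hS : S ⊆ R) (x y : V) :
    degIn G (S : Set V) x = degIn G (S : Set V) y ↔
      #(S ∩ {v ∈ R | G.Adj x v ∧ ¬ G.Adj y v})
        = #{v ∈ S \ {v ∈ R | G.Adj x v ∧ ¬ G.Adj y v} | G.Adj y v ∧ ¬ G.Adj x v} := by
  rw [degIn_coe_eq_card_filter, degIn_coe_eq_card_filter]
  have h1 := card_filter_add_card_filter_not (s := {v ∈ S | G.Adj x v}) (fun v => G.Adj y v)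
  have h2 := card_filter_add_card_filter_not (s := {v ∈ S | G.Adj y v}) (fun v => G.Adj x v)
  simp only [filter_filter] at h1 h2
  have e1 : S ∩ {v ∈ R | G.Adj x v ∧ ¬ G.Adj y v} = {v ∈ S | G.Adj x v ∧ ¬ G.Adj y v} := by
    grind
  have e2 : {v ∈ S \ {v ∈ R | G.Adj x v ∧ ¬ G.Adj y v} | G.Adj y v ∧ ¬ G.Adj x v}
      = {v ∈ S | G.Adj y v ∧ ¬ G.Adj x v} := by
    grind
  have e3 : {v ∈ S | G.Adj x v ∧ G.Adj y v} = {v ∈ S | G.Adj y v ∧ G.Adj x v} := by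
    grind
  rw [e1, e2]
  rw [e3] at h1
  omega

open Classical in
theorem sum_bernoulliWeight_degIn_eq_le_of_card {p : ℝ} (hp : 0 < p) (hp2 : p ≤ 1 / 2)
    (G : SimpleGraph V) (R : Finset V) (x y : V) :
    ∑ S ∈ R.powerset, bernoulliWeight p #R #S *
        (if degIn G (S : Set V) x = degIn G (S : Set V) y then 1 else 0)
      ≤ 1 / (p * √(#{v ∈ R | G.Adj x v ∧ ¬ G.Adj y v} + 1)) := by
  refine le_trans (le_of_eq (sum_congr rfl fun S hS => ?_))
    (sum_bernoulliWeight_card_inter_eq_le hp hp2 (filter_subset _ R)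
      (fun T => #{v ∈ T | G.Adj y v ∧ ¬ G.Adj x v}))
  simp only [degIn_eq_iff G (mem_powerset.1 hS) x y]

variable [Fintype V]

open Classical in
theorem ncard_symmDiff_neighborSet_le (G : SimpleGraph V) (W : Finset V) (x y : V) :
    (symmDiff (G.neighborSet x) (G.neighborSet y)).ncard ≤
      #{v ∈ univ \ W | G.Adj x v ∧ ¬ G.Adj y v}
        + #{v ∈ univ \ W | G.Adj y v ∧ ¬ G.Adj x v} + #W := by
  calc _ ≤ (({v ∈ univ \ W | G.Adj x v ∧ ¬ G.Adj y v}
          ∪ {v ∈ univ \ W | G.Adj y v ∧ ¬ G.Adj x v} ∪ W : Finset V) : Set V).ncard := by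
        refine Set.ncard_le_ncard (fun v hv => ?_) (Finset.finite_toSet _)
        simp only [Set.mem_symmDiff, SimpleGraph.mem_neighborSet] at hv
        simp only [coe_union, coe_filter, mem_sdiff, mem_univ, true_and, Set.mem_union,
          Set.mem_ofPred_eq, mem_coe]
        tauto
    _ ≤ _ := by
        rw [Set.ncard_coe_finset]
        exact (card_union_le _ _).trans (Nat.add_le_add_right (card_union_le _ _) _)

open Classical in
theorem sum_bernoulliWeight_degIn_eq_le {p : ℝ} (hp : 0 < p) (hp2 : p ≤ 1 / 2)
    (G : SimpleGraph V) (W : Finset V) (x y : V) {d : ℝ} (hd : 0 < d)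
    (h : 2 * d + #W ≤ (symmDiff (G.neighborSet x) (G.neighborSet y)).ncard) :
    ∑ S ∈ (univ \ W).powerset, bernoulliWeight p #(univ \ W) #S *
        (if degIn G (S : Set V) x = degIn G (S : Set V) y then 1 else 0)
      ≤ 1 / (p * √d) := by
  have h1 : ((symmDiff (G.neighborSet x) (G.neighborSet y)).ncard : ℝ) ≤
      #{v ∈ univ \ W | G.Adj x v ∧ ¬ G.Adj y v}
        + #{v ∈ univ \ W | G.Adj y v ∧ ¬ G.Adj x v} + #W := by
    exact_mod_cast ncard_symmDiff_neighborSet_le G W x y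
  rcases le_or_gt d #{v ∈ univ \ W | G.Adj x v ∧ ¬ G.Adj y v} with h2 | h2
  · refine (sum_bernoulliWeight_degIn_eq_le_of_card hp hp2 G (univ \ W) x y).trans ?_
    gcongr
    linarith
  · simp_rw [eq_comm (a := degIn G _ x)]
    refine (sum_bernoulliWeight_degIn_eq_le_of_card hp hp2 G (univ \ W) y x).trans ?_
    gcongr
    linarith

open Classical in
theorem sum_bernoulliWeight_mul_ncard_collisions_le {p : ℝ} (hp : 0 < p) (hp2 : p ≤ 1 / 2)
    {c δ d : ℝ} (hd : 0 < d) [LinearOrder V] {G : SimpleGraph V} (hG : Diverse c δ G)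
    (W : Finset V) (h : 2 * d + #W ≤ c * Fintype.card V) :
    ∑ S ∈ (univ \ W).powerset, bernoulliWeight p #(univ \ W) #S *
        (({q : V × V | q.1 ∈ W ∧ q.2 ∈ W ∧ q.1 < q.2 ∧
          degIn G (S : Set V) q.1 = degIn G (S : Set V) q.2}).ncard : ℝ)
      ≤ #W * (Fintype.card V : ℝ) ^ δ + #W * (#W * (1 / (p * √d))) := by
  set prob : V → V → ℝ := fun x y =>
    ∑ S ∈ (univ \ W).powerset, bernoulliWeight p #(univ \ W) #S *
        (if degIn G (S : Set V) x = degIn G (S : Set V) y then 1 else 0)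
  have hw (S : Finset V) : 0 ≤ bernoulliWeight p #(univ \ W) #S :=
    bernoulliWeight_nonneg hp.le (by linarith) _ _
  have hcount (S : Finset V) : (({q : V × V | q.1 ∈ W ∧ q.2 ∈ W ∧ q.1 < q.2 ∧
          degIn G (S : Set V) q.1 = degIn G (S : Set V) q.2}).ncard : ℝ)
      ≤ ∑ x ∈ W, ∑ y ∈ W, if degIn G (S : Set V) x = degIn G (S : Set V) y then 1 else 0 := by
    rw [← sum_product' (f := fun x y =>
      if degIn G (S : Set V) x = degIn G (S : Set V) y then (1 : ℝ) else 0), sum_boole,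
      ← Set.ncard_coe_finset]
    refine Nat.cast_le.2 (Set.ncard_le_ncard (fun q hq => ?_) (Finset.finite_toSet _))
    simp only [Set.mem_ofPred_eq] at hq
    simp only [coe_filter, mem_product, Set.mem_ofPred_eq]
    tauto
  have hprob_le (x y : V) : prob x y ≤
      (if ((symmDiff (G.neighborSet x) (G.neighborSet y)).ncard : ℝ) < c * Fintype.card V
        then 1 else 0) + 1 / (p * √d) := by
    split_ifs with hxy
    · have h1 : prob x y ≤ 1 := by
        rw [← sum_powerset_bernoulliWeight p (univ \ W)]
        refine sum_le_sum fun S _ => mul_le_of_le_one_right (hw S) ?_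
        split_ifs <;> norm_num
      have h2 : 0 ≤ 1 / (p * √d) := by positivity
      linarith
    · rw [zero_add]
      exact sum_bernoulliWeight_degIn_eq_le hp hp2 G W x y hd (h.trans (not_lt.1 hxy))
  calc _ ≤ ∑ S ∈ (univ \ W).powerset, bernoulliWeight p #(univ \ W) #S *
          ∑ x ∈ W, ∑ y ∈ W, if degIn G (S : Set V) x = degIn G (S : Set V) y then 1 else 0 :=
        sum_le_sum fun S _ => mul_le_mul_of_nonneg_left (hcount S) (hw S)
    _ = ∑ x ∈ W, ∑ y ∈ W, prob x y := by
        simp_rw [mul_sum]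
        rw [sum_comm]
        exact sum_congr rfl fun x _ => sum_comm
    _ ≤ ∑ x ∈ W, ((Fintype.card V : ℝ) ^ δ + #W * (1 / (p * √d))) := by
        refine sum_le_sum fun x _ => (sum_le_sum fun y _ => hprob_le x y).trans ?_
        rw [sum_add_distrib, sum_const, nsmul_eq_mul, sum_boole]
        gcongr
        refine le_trans ?_ (hG x)
        rw [← Set.ncard_coe_finset]
        refine Nat.cast_le.2 (Set.ncard_le_ncard (fun y hy => ?_) (Set.toFinite _))
        simp only [coe_filter, Set.mem_ofPred_eq] at hy
        exact hy.2
    _ = _ := by rw [sum_const, nsmul_eq_mul, mul_add]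

end Degrees

/-- Claim 5 (expected number of degree collisions): for all `c, δ, c₁ ∈ (0,1)` and all
sufficiently large `n`, if `G` is a `(c, δ)`-diverse graph on `n` vertices, `W₁` is a set of
exactly `⌈n^{1/2}⌉` vertices, `√c₁ ≤ p ≤ 1/2`, and `U` is a `p`-random subset of `V ∖ W₁`
(so the subset `S ⊆ V ∖ W₁` occurs with probability `p^{|S|}(1-p)^{|V ∖ W₁| - |S|}`), then
the expected number of unordered pairs `{x, y} ⊆ W₁` with `deg_U(x) = deg_U(y)` is at most
`2 |W₁| n^δ`. -/
theorem expected_degree_collisions (c δ c₁ : ℝ)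
    (hc0 : 0 < c) (hc1 : c < 1) (hδ0 : 0 < δ) (hδ1 : δ < 1)
    (hc₁0 : 0 < c₁) (hc₁1 : c₁ < 1) :
    ∃ N : ℕ, ∀ n : ℕ, N ≤ n →
      ∀ G : SimpleGraph (Fin n), Diverse c δ G →
        ∀ W₁ : Finset (Fin n), W₁.card = ⌈Real.sqrt n⌉₊ →
          ∀ p : ℝ, Real.sqrt c₁ ≤ p → p ≤ 1 / 2 →
            ∑ S ∈ ((Finset.univ : Finset (Fin n)) \ W₁).powerset,
                p ^ S.card * (1 - p) ^ (((Finset.univ : Finset (Fin n)) \ W₁).card - S.card)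
                  * (({q : Fin n × Fin n | q.1 ∈ W₁ ∧ q.2 ∈ W₁ ∧ q.1 < q.2 ∧
                      degIn G (S : Set (Fin n)) q.1 = degIn G (S : Set (Fin n)) q.2}).ncard : ℝ)
              ≤ 2 * (W₁.card : ℝ) * (n : ℝ) ^ δ := by
  have hs : 0 < √c₁ := Real.sqrt_pos.2 hc₁0
  have hsc : 0 < √c := Real.sqrt_pos.2 hc0
  have hroot : ∀ᶠ n : ℕ in Filter.atTop, max 1 (4 / c) ≤ √(n : ℝ) :=
    (Real.tendsto_sqrt_atTop.comp tendsto_natCast_atTop_atTop).eventually_ge_atTop _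
  have hpow : ∀ᶠ n : ℕ in Filter.atTop, 4 / (√c₁ * √c) ≤ (n : ℝ) ^ δ :=
    ((tendsto_rpow_atTop hδ0).comp tendsto_natCast_atTop_atTop).eventually_ge_atTop _
  obtain ⟨N, hN⟩ := Filter.eventually_atTop.1 (hroot.and hpow)
  refine ⟨N, fun n hn G hG W₁ hW p hp hp2 => ?_⟩
  obtain ⟨hr, hnδ⟩ := hN n hn
  have hr1 : 1 ≤ √(n : ℝ) := (le_max_left _ _).trans hr
  have hr4 : 4 ≤ √(n : ℝ) * c := (div_le_iff₀ hc0).1 ((le_max_right _ _).trans hr)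
  have hr2 : √(n : ℝ) ^ 2 = n := Real.sq_sqrt (by positivity)
  have hn0 : (0 : ℝ) < n := by nlinarith
  have hW2 : (#W₁ : ℝ) ≤ 2 * √(n : ℝ) := by
    have h := Nat.ceil_lt_add_one (Real.sqrt_nonneg (n : ℝ))
    rw [hW]
    linarith
  have hd : 2 * (c * n / 4) + #W₁ ≤ c * Fintype.card (Fin n) := by
    rw [Fintype.card_fin]
    nlinarith
  have hmain := sum_bernoulliWeight_mul_ncard_collisions_le (hs.trans_le hp) hp2
    (by positivity) hG W₁ hd
  rw [Fintype.card_fin] at hmain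
  have hgood : (#W₁ : ℝ) * (1 / (p * √(c * n / 4))) ≤ (n : ℝ) ^ δ := by
    have hsqrt : √(c * n / 4) = √c * √(n : ℝ) / 2 := by
      rw [Real.sqrt_div (by positivity), Real.sqrt_mul hc0.le,
        show (4 : ℝ) = 2 ^ 2 by norm_num, Real.sqrt_sq two_pos.le]
    have hp0 : 0 < p := hs.trans_le hp
    rw [hsqrt]
    calc (#W₁ : ℝ) * (1 / (p * (√c * √(n : ℝ) / 2)))
        ≤ 2 * √(n : ℝ) * (1 / (√c₁ * (√c * √(n : ℝ) / 2))) := by gcongr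
      _ = 4 / (√c₁ * √c) := by field_simp; norm_num
      _ ≤ (n : ℝ) ^ δ := hnδ
  calc _ ≤ (#W₁ : ℝ) * (n : ℝ) ^ δ + #W₁ * (#W₁ * (1 / (p * √(c * n / 4)))) := hmain
    _ ≤ (#W₁ : ℝ) * (n : ℝ) ^ δ + #W₁ * (n : ℝ) ^ δ := by gcongr
    _ = _ := by ring
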